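/- Let E be an open set in ℂⁿ, let D be a bounded open set with closure contained in E, and let f, g : E → ℂⁿ be holomorphic maps such that f(z) ≠ 0 for every z ∈ ∂D and ‖g(z)‖ < ‖f(z)‖ for every z ∈ ∂D (Euclidean norm on ℂⁿ). Assume moreover that f has exactly one zero z₀ in D and that the Fréchet derivative of f at z₀ is an invertible linear map of ℂⁿ. Then f + g has exactly one zero in D, i.e. there exists a unique z ∈ D with f(z) + g(z) = 0. -/

import Mathlib

open scoped Topology
open Filter Set Metric

theorem differentiableAt_fderiv_apply_of_differentiableOn_complex
    {V F : Type*} [NormedAddCommGroup V] [NormedSpace ℂ V] [FiniteDimensional ℂ V]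
    [NormedAddCommGroup F] [NormedSpace ℂ F] [FiniteDimensional ℂ F]
    {f : V → F} {E : Set V} (hE : IsOpen E) (hf : DifferentiableOn ℂ f E)
    {z₀ : V} (hz₀ : z₀ ∈ E) (v : V) :
    DifferentiableAt ℂ (fun z => fderiv ℂ f z v) z₀ := by
  have : CompleteSpace F := FiniteDimensional.complete ℂ F
  have : ProperSpace (V →L[ℂ] F) := FiniteDimensional.proper ℂ _
  borelize V (V →L[ℂ] F)
  obtain ⟨R, hR, hRE, hRM⟩ : ∃ R > 0, ball z₀ R ⊆ E ∧ ∀ z ∈ ball z₀ R, ‖f z - f z₀‖ ≤ 1 := by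
    have h1 := (hf.differentiableAt (hE.mem_nhds hz₀)).continuousAt
    have h2 : ∀ᶠ z in 𝓝 z₀, z ∈ E ∧ ‖f z - f z₀‖ ≤ 1 := by
      filter_upwards [hE.mem_nhds hz₀, h1 (Metric.closedBall_mem_nhds (f z₀) one_pos)] with z h h'
      exact ⟨h, by simpa [dist_eq_norm] using h'⟩
    obtain ⟨R, hR, h⟩ := Metric.eventually_nhds_iff_ball.1 h2
    exact ⟨R, hR, fun z hz => (h z hz).1, fun z hz => (h z hz).2⟩
  have hdiff : ∀ z ∈ ball z₀ R, DifferentiableAt ℂ f z := fun z hz =>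
    hf.differentiableAt (hE.mem_nhds (hRE hz))
  have hfderiv : ∀ z ∈ ball z₀ (R / 2), ‖fderiv ℂ f z‖ ≤ 2 / (R / 2) := by
    intro z hz
    rw [mem_ball] at hz
    have hsub : ball z (R / 2) ⊆ ball z₀ R := ball_subset_ball' (by linarith)
    refine Complex.norm_fderiv_le_div_of_mapsTo_ball
      (fun w hw => (hdiff w (hsub hw)).differentiableWithinAt) (fun w hw => ?_) (by positivity)
    have h1 := hRM w (hsub hw)
    have h2 := hRM z (ball_subset_ball (by linarith) (mem_ball.2 hz))
    rw [mem_closedBall, dist_eq_norm]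
    calc ‖f w - f z‖ = ‖(f w - f z₀) - (f z - f z₀)‖ := by congr 1; abel
      _ ≤ 2 := (norm_sub_le _ _).trans (by linarith)
  obtain ⟨ρ, hρ, hρv⟩ : ∃ ρ > 0, ρ * ‖v‖ < R / 4 := by
    refine ⟨R / 4 / (‖v‖ + 1), by positivity, ?_⟩
    rw [div_mul_eq_mul_div, div_lt_iff₀ (by positivity)]
    nlinarith [norm_nonneg v]
  have hmem : ∀ z ∈ ball z₀ (R / 4), ∀ τ : ℂ, ‖τ‖ * ‖v‖ < R / 4 → z + τ • v ∈ ball z₀ (R / 2) := by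
    intro z hz τ hτ
    rw [mem_ball, dist_eq_norm] at *
    calc ‖z + τ • v - z₀‖ = ‖(z - z₀) + τ • v‖ := by congr 1; abel
      _ < R / 2 := (norm_add_le _ _).trans_lt (by rw [norm_smul]; linarith)
  have hsub : ball z₀ (R / 2) ⊆ ball z₀ R := ball_subset_ball (by linarith)
  have hcirc : ∀ θ : ℝ, ‖circleMap 0 ρ θ‖ * ‖v‖ < R / 4 := fun θ => by
    simpa [abs_of_pos hρ] using hρv
  set k : ℝ → ℂ := fun θ => deriv (circleMap 0 ρ) θ * ((circleMap 0 ρ θ - 0) ^ 2)⁻¹ with hk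
  have hkc : Continuous k := by
    have h0 : ∀ θ, (circleMap 0 ρ θ - 0) ^ 2 ≠ 0 := fun θ => by
      simpa using hρ.ne'
    have h1 : Continuous fun θ => ((circleMap 0 ρ θ - 0) ^ 2)⁻¹ :=
      Continuous.inv₀ (by fun_prop) h0
    have h2 : Continuous (deriv (circleMap 0 ρ)) := by
      simp only [funext (deriv_circleMap 0 ρ)]; fun_prop
    exact h2.mul h1
  have hline : ∀ z ∈ ball z₀ (R / 4), ∀ τ : ℂ, ‖τ‖ * ‖v‖ < R / 4 →
      HasDerivAt (fun τ : ℂ => f (z + τ • v)) (fderiv ℂ f (z + τ • v) v) τ := by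
    intro z hz τ hτ
    have h1 := (hdiff _ (hsub (hmem z hz τ hτ))).hasFDerivAt
    have h2 : HasDerivAt (fun τ : ℂ => z + τ • v) v τ := by
      simpa using ((hasDerivAt_id τ).smul_const v).const_add z
    exact h1.comp_hasDerivAt τ h2
  have hcauchy : ∀ z ∈ ball z₀ (R / 4), fderiv ℂ f z v =
      (2 * Real.pi * Complex.I : ℂ)⁻¹ •
        ∫ θ in (0 : ℝ)..2 * Real.pi, k θ • f (z + circleMap 0 ρ θ • v) := by
    intro z hz
    have hU : IsOpen {τ : ℂ | ‖τ‖ * ‖v‖ < R / 4} := isOpen_lt (by fun_prop) continuous_const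
    have h := Complex.two_pi_I_inv_smul_circleIntegral_sub_sq_inv_smul_of_differentiable hU
      (c := 0) (w₀ := 0) (R := ρ) (f := fun τ : ℂ => f (z + τ • v)) (fun τ hτ => by
        rw [mem_closedBall_zero_iff] at hτ
        exact (mul_le_mul_of_nonneg_right hτ (norm_nonneg v)).trans_lt hρv)
      (fun τ hτ => (hline z hz τ hτ).differentiableAt.differentiableWithinAt)
      (mem_ball_self hρ)
    rw [(hline z hz 0 (by simpa using by positivity)).deriv] at h
    simp only [zero_smul, add_zero] at h
    rw [← h, circleIntegral]
    simp only [smul_smul, hk]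
  have hz₀mem : ball z₀ (R / 4) ∈ 𝓝 z₀ := ball_mem_nhds _ (by positivity)
  have hcont : ∀ z ∈ ball z₀ (R / 4),
      Continuous fun θ : ℝ => k θ • f (z + circleMap 0 ρ θ • v) := by
    intro z hz
    refine hkc.smul (continuous_iff_continuousAt.2 fun θ => ?_)
    exact ContinuousAt.comp (f := fun θ : ℝ => z + circleMap 0 ρ θ • v)
      (hdiff _ (hsub (hmem z hz _ (hcirc θ)))).continuousAt
      (by fun_prop)
  have hintegral : HasFDerivAt
      (fun z => ∫ θ in (0 : ℝ)..2 * Real.pi, k θ • f (z + circleMap 0 ρ θ • v))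
      (∫ θ in (0 : ℝ)..2 * Real.pi, k θ • fderiv ℂ f (z₀ + circleMap 0 ρ θ • v)) z₀ := by
    refine intervalIntegral.hasFDerivAt_integral_of_dominated_of_fderiv_le
      (F := fun z θ => k θ • f (z + circleMap 0 ρ θ • v))
      (F' := fun z θ => k θ • fderiv ℂ f (z + circleMap 0 ρ θ • v))
      (bound := fun θ => ‖k θ‖ * (2 / (R / 2))) hz₀mem ?_ ?_ ?_ ?_ ?_ ?_
    · filter_upwards [hz₀mem] with z hz
      exact (hcont z hz).aestronglyMeasurable
    · exact (hcont z₀ (mem_of_mem_nhds hz₀mem)).intervalIntegrable _ _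
    · have h1 : Measurable fun θ : ℝ => fderiv ℂ f (z₀ + circleMap 0 ρ θ • v) :=
        (measurable_fderiv ℂ f).comp (by fun_prop : Continuous fun θ : ℝ =>
          z₀ + circleMap 0 ρ θ • v).measurable
      exact hkc.aestronglyMeasurable.smul h1.aestronglyMeasurable
    · refine Eventually.of_forall fun θ _ z hz => ?_
      rw [norm_smul]
      exact mul_le_mul_of_nonneg_left (hfderiv _ (hmem z hz _ (hcirc θ))) (norm_nonneg _)
    · exact (hkc.norm.mul continuous_const).intervalIntegrable _ _
    · refine Eventually.of_forall fun θ _ z hz => ?_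
      have h1 := (hdiff _ (hsub (hmem z hz _ (hcirc θ)))).hasFDerivAt
      have h2 : HasFDerivAt (fun z : V => z + circleMap 0 ρ θ • v) (.id ℂ V) z :=
        (hasFDerivAt_id z).add_const _
      exact (h1.comp z h2).const_smul (k θ)
  refine ((hintegral.const_smul (2 * Real.pi * Complex.I : ℂ)⁻¹).differentiableAt).congr_of_eventuallyEq ?_
  filter_upwards [hz₀mem] with z hz
  exact hcauchy z hz

theorem contDiffOn_of_differentiableOn_complex
    {V F : Type*} [NormedAddCommGroup V] [NormedSpace ℂ V] [FiniteDimensional ℂ V]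
    [NormedAddCommGroup F] [NormedSpace ℂ F] [FiniteDimensional ℂ F]
    {E : Set V} (hE : IsOpen E) (m : ℕ) :
    ∀ {f : V → F}, DifferentiableOn ℂ f E → ContDiffOn ℂ m f E := by
  induction m with
  | zero => intro f hf; exact contDiffOn_zero.2 hf.continuousOn
  | succ m ih =>
    intro f hf
    push_cast
    rw [contDiffOn_succ_iff_fderiv_of_isOpen hE]
    refine ⟨hf, by simp, contDiffOn_clm_apply.2 fun v => ih fun z hz => ?_⟩
    exact (differentiableAt_fderiv_apply_of_differentiableOn_complex hE hf hz v).differentiableWithinAt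

theorem eventually_forall_ne_zero_of_isCompact {P V W : Type*} [TopologicalSpace P]
    [TopologicalSpace V] [NormedAddCommGroup W] {H : P × V → W} {p₀ : P} {K : Set V}
    (hK : IsCompact K) (hH : ∀ z ∈ K, ContinuousAt H (p₀, z)) (h0 : ∀ z ∈ K, H (p₀, z) ≠ 0) :
    ∀ᶠ p in 𝓝 p₀, ∀ z ∈ K, H (p, z) ≠ 0 :=
  hK.eventually_forall_of_forall_eventually fun z hz => (hH z hz).eventually_ne (h0 z hz)

section NondegenerateZero

variable {P V : Type*} [NormedAddCommGroup P] [NormedSpace ℝ P]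
  [NormedAddCommGroup V] [NormedSpace ℝ V] [FiniteDimensional ℝ V]
  {H : P × V → V} {p₀ : P} {a : V}

theorem isInvertible_fderiv_comp_inr_of_injective
    (hinj : ∀ v, fderiv ℝ H (p₀, a) (0, v) = 0 → v = 0) :
    (fderiv ℝ H (p₀, a) ∘L .inr ℝ P V).IsInvertible := by
  have hi : Function.Injective (fderiv ℝ H (p₀, a) ∘L .inr ℝ P V).toLinearMap :=
    (injective_iff_map_eq_zero _).2 fun v hv => hinj v (by simpa using hv)
  exact ⟨(LinearEquiv.ofInjectiveEndo _ hi).toContinuousLinearEquiv, by ext; rfl⟩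

variable [CompleteSpace P]

theorem eventually_exists_zero_of_nondegenerate (hH : ContDiffAt ℝ 1 H (p₀, a))
    (h0 : H (p₀, a) = 0) (hinj : ∀ v, fderiv ℝ H (p₀, a) (0, v) = 0 → v = 0)
    {W : Set V} (hW : W ∈ 𝓝 a) : ∀ᶠ p in 𝓝 p₀, ∃ z ∈ W, H (p, z) = 0 := by
  have : CompleteSpace V := FiniteDimensional.complete ℝ V
  have hs := hH.hasStrictFDerivAt one_ne_zero
  have hinv := isInvertible_fderiv_comp_inr_of_injective hinj
  filter_upwards [hs.eventually_apply_implicitFunctionOfProdDomain hinv,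
    (hs.tendsto_implicitFunctionOfProdDomain hinv).eventually hW] with p hp hpW
  exact ⟨_, hpW, hp.trans h0⟩

theorem exists_nhds_eventually_zero_unique_of_nondegenerate (hH : ContDiffAt ℝ 1 H (p₀, a))
    (h0 : H (p₀, a) = 0) (hinj : ∀ v, fderiv ℝ H (p₀, a) (0, v) = 0 → v = 0) :
    ∃ W, IsOpen W ∧ a ∈ W ∧
      ∀ᶠ p in 𝓝 p₀, ∀ z ∈ W, ∀ z' ∈ W, H (p, z) = 0 → H (p, z') = 0 → z = z' := by
  have : CompleteSpace V := FiniteDimensional.complete ℝ V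
  have hs := hH.hasStrictFDerivAt one_ne_zero
  have hinv := isInvertible_fderiv_comp_inr_of_injective hinj
  have h := hs.eventually_apply_eq_iff_implicitFunctionOfProdDomain hinv
  rw [nhds_prod_eq] at h
  obtain ⟨p, hp, q, hq, hpq⟩ := eventually_prod_iff.1 h
  obtain ⟨W, hWq, hW, haW⟩ := _root_.mem_nhds_iff.1 hq
  refine ⟨W, hW, haW, hp.mono fun x hx z hz z' hz' h1 h2 => ?_⟩
  exact ((hpq hx (hWq hz)).1 (h1.trans h0.symm)).symm.trans
    ((hpq hx (hWq hz')).1 (h2.trans h0.symm))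

theorem eventually_existsUnique_zero_iff {D : Set V} (hD : IsOpen D)
    (hDb : Bornology.IsBounded D) (hH : ∀ z ∈ closure D, ContDiffAt ℝ 1 H (p₀, z))
    (hfr : ∀ z ∈ frontier D, H (p₀, z) ≠ 0)
    (hinj : ∀ z ∈ D, H (p₀, z) = 0 → ∀ v, fderiv ℝ H (p₀, z) (0, v) = 0 → v = 0) :
    ∀ᶠ p in 𝓝 p₀, ((∃! z, z ∈ D ∧ H (p, z) = 0) ↔ ∃! z, z ∈ D ∧ H (p₀, z) = 0) := by
  have : ProperSpace V := FiniteDimensional.proper_real V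
  have hK : IsCompact (closure D) := hDb.isCompact_closure
  have hfD : ∀ z ∈ closure D, z ∉ D → z ∈ frontier D := fun z hz hzD => by
    rw [hD.frontier_eq]; exact ⟨hz, hzD⟩
  by_cases hex : ∃ a ∈ D, H (p₀, a) = 0
  · obtain ⟨a, haD, ha⟩ := hex
    have hca := hH a (subset_closure haD)
    by_cases huniq : ∀ z ∈ D, H (p₀, z) = 0 → z = a
    · obtain ⟨W, hW, haW, hWu⟩ :=
        exists_nhds_eventually_zero_unique_of_nondegenerate hca ha (hinj a haD ha)
      have hne := eventually_forall_ne_zero_of_isCompact (p₀ := p₀) (H := H)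
        (hK.diff hW) (fun z hz => (hH z hz.1).continuousAt) fun z hz h => by
          by_cases hzD : z ∈ D
          · exact hz.2 (huniq z hzD h ▸ haW)
          · exact hfr z (hfD z hz.1 hzD) h
      filter_upwards [hWu, hne, eventually_exists_zero_of_nondegenerate hca ha (hinj a haD ha)
        ((hD.inter hW).mem_nhds ⟨haD, haW⟩)] with p h1 h2 ⟨z, hz, hz0⟩
      have hin : ∀ y ∈ D, H (p, y) = 0 → y ∈ W := fun y hy hy0 => by
        by_contra hyW
        exact h2 y ⟨subset_closure hy, hyW⟩ hy0
      exact iff_of_true ⟨z, ⟨hz.1, hz0⟩, fun y hy => h1 y (hin y hy.1 hy.2) z hz.2 hy.2 hz0⟩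
        ⟨a, ⟨haD, ha⟩, fun y hy => huniq y hy.1 hy.2⟩
    · push Not at huniq
      obtain ⟨b, hbD, hb, hba⟩ := huniq
      obtain ⟨A, B, hA, hB, hbA, haB, hAB⟩ := t2_separation hba
      filter_upwards [eventually_exists_zero_of_nondegenerate hca ha (hinj a haD ha)
          ((hD.inter hB).mem_nhds ⟨haD, haB⟩),
        eventually_exists_zero_of_nondegenerate (hH b (subset_closure hbD)) hb (hinj b hbD hb)
          ((hD.inter hA).mem_nhds ⟨hbD, hbA⟩)] with p ⟨x, hx, hx0⟩ ⟨y, hy, hy0⟩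
      refine iff_of_false (fun h => ?_) (fun h => hba (h.unique ⟨hbD, hb⟩ ⟨haD, ha⟩))
      exact hAB.ne_of_mem hy.2 hx.2 (h.unique ⟨hy.1, hy0⟩ ⟨hx.1, hx0⟩)
  · push Not at hex
    have hne := eventually_forall_ne_zero_of_isCompact (p₀ := p₀) (H := H) hK
      (fun z hz => (hH z hz).continuousAt) fun z hz h => by
        by_cases hzD : z ∈ D
        · exact hex z hzD h
        · exact hfr z (hfD z hz hzD) h
    filter_upwards [hne] with p hp
    exact iff_of_false (fun ⟨z, hz, _⟩ => hp z (subset_closure hz.1) hz.2)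
      (fun ⟨z, hz, _⟩ => hex z hz.1 hz.2)

end NondegenerateZero

theorem Module.Basis.contDiff_coord {ι V : Type*} [NormedAddCommGroup V] [NormedSpace ℂ V]
    [FiniteDimensional ℂ V] (b : Module.Basis ι ℂ V) (i : ι) {m : WithTop ℕ∞} :
    ContDiff ℝ m (b.coord i) :=
  ((LinearMap.toContinuousLinearMap (b.coord i)).contDiff).restrict_scalars ℝ

theorem contDiffAt_real_of_differentiableOn_complex {V F : Type*} [NormedAddCommGroup V]
    [NormedSpace ℂ V] [FiniteDimensional ℂ V] [NormedAddCommGroup F] [NormedSpace ℂ F]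
    [FiniteDimensional ℂ F] {f : V → F} {E : Set V} (hE : IsOpen E)
    (hf : DifferentiableOn ℂ f E) (m : ℕ) {z : V} (hz : z ∈ E) : ContDiffAt ℝ m f z :=
  ((contDiffOn_of_differentiableOn_complex hE m hf).contDiffAt (hE.mem_nhds hz)).restrict_scalars ℝ

section AffinePerturbation

variable {ι V : Type*} [Fintype ι] [NormedAddCommGroup V] [NormedSpace ℂ V]
  (b : Module.Basis ι ℂ V) (f g : V → V)

/-- The family `z ↦ f z + s • g z + A z - w`, with parameters `s`, the columns `c` of the linear map
`A` in the basis `b`, and `w`. -/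
noncomputable def affinePerturbation (x : (ℝ × (ι → V) × V) × V) : V :=
  f x.2 + x.1.1 • g x.2 + ∑ i, b.coord i x.2 • x.1.2.1 i - x.1.2.2

variable [FiniteDimensional ℂ V] {b f g} {E : Set V}

theorem contDiffAt_affinePerturbation (hE : IsOpen E) (hf : DifferentiableOn ℂ f E)
    (hg : DifferentiableOn ℂ g E) (p : ℝ × (ι → V) × V) {z : V} (hz : z ∈ E) :
    ContDiffAt ℝ 1 (affinePerturbation b f g) (p, z) := by
  have hf1 := (contDiffAt_real_of_differentiableOn_complex hE hf 1 hz).comp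
    (f := Prod.snd) (p, z) contDiffAt_snd
  have hg1 := (contDiffAt_real_of_differentiableOn_complex hE hg 1 hz).comp
    (f := Prod.snd) (p, z) contDiffAt_snd
  have hl : ∀ i, ContDiff ℝ 1 fun x : (ℝ × (ι → V) × V) × V => b.coord i x.2 := fun i =>
    (b.contDiff_coord i).comp contDiff_snd
  refine ((hf1.add (ContDiffAt.smul (f := fun x : (ℝ × (ι → V) × V) × V => x.1.1) (by fun_prop) hg1)).add
    (ContDiffAt.sum fun i _ => ?_)).sub (by fun_prop)
  exact (hl i).contDiffAt.smul (by fun_prop)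

theorem fderiv_affinePerturbation_inr (hE : IsOpen E) (hf : DifferentiableOn ℂ f E)
    (hg : DifferentiableOn ℂ g E) (p : ℝ × (ι → V) × V) {z : V} (hz : z ∈ E) (v : V) :
    fderiv ℝ (affinePerturbation b f g) (p, z) (0, v) =
      fderiv ℂ f z v + p.1 • fderiv ℂ g z v + ∑ i, b.coord i v • p.2.1 i := by
  have h1 : HasFDerivAt (affinePerturbation b f g) (fderiv ℝ (affinePerturbation b f g) (p, z))
      (p, z) :=
    ((contDiffAt_affinePerturbation hE hf hg p hz).differentiableAt one_ne_zero).hasFDerivAt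
  have h2 := h1.comp z (hasFDerivAt_prodMk_right p z)
  have hf1 := ((hf.differentiableAt (hE.mem_nhds hz)).hasFDerivAt).restrictScalars ℝ
  have hg1 := ((hg.differentiableAt (hE.mem_nhds hz)).hasFDerivAt).restrictScalars ℝ
  have hl : ∀ i, HasFDerivAt (fun z => b.coord i z)
      ((LinearMap.toContinuousLinearMap (b.coord i)).restrictScalars ℝ) z := fun i =>
    ((LinearMap.toContinuousLinearMap (b.coord i)).hasFDerivAt).restrictScalars ℝ
  have h3 := ((hf1.add (hg1.const_smul p.1)).add
    (HasFDerivAt.fun_sum fun i (_ : i ∈ Finset.univ) => (hl i).smul_const (p.2.1 i))).sub_const p.2.2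
  have h4 := DFunLike.congr_fun (h2.unique h3) v
  simpa using h4

theorem eventually_affinePerturbation_existsUnique_iff {D : Set V}
    (hE : IsOpen E) (hD : IsOpen D)
    (hDb : Bornology.IsBounded D) (hDE : closure D ⊆ E)
    (hf : DifferentiableOn ℂ f E) (hg : DifferentiableOn ℂ g E) (p : ℝ × (ι → V) × V)
    (hfr : ∀ z ∈ frontier D, affinePerturbation b f g (p, z) ≠ 0)
    (hinj : ∀ z ∈ D, affinePerturbation b f g (p, z) = 0 → ∀ v,
      fderiv ℂ f z v + p.1 • fderiv ℂ g z v + ∑ i, b.coord i v • p.2.1 i = 0 → v = 0) :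
    ∀ᶠ q in 𝓝 p, ((∃! z, z ∈ D ∧ affinePerturbation b f g (q, z) = 0) ↔
      ∃! z, z ∈ D ∧ affinePerturbation b f g (p, z) = 0) := by
  have : CompleteSpace V := FiniteDimensional.complete ℝ V
  refine eventually_existsUnique_zero_iff hD hDb
    (fun z hz => contDiffAt_affinePerturbation hE hf hg p (hDE hz)) hfr fun z hz h v hv => ?_
  rw [fderiv_affinePerturbation_inr hE hf hg p (hDE (subset_closure hz))] at hv
  exact hinj z hz h v hv

end AffinePerturbation

section Density

variable {ι V : Type*} [Fintype ι] [DecidableEq ι] [NormedAddCommGroup V] [NormedSpace ℂ V]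
  {b : Module.Basis ι ℂ V} {f g : V → V} {E : Set V}

/-- For the vector `v = b j + ∑ i ≠ j, u i • b i`, the parameters for which `z` is a zero of the
member of the affine perturbation with time `s` and columns `d` off `j`, with derivative
killing `v`. -/
noncomputable def degenerateParameter (b : Module.Basis ι ℂ V) (f g : V → V) (j : ι)
    (x : V × ℝ × ({i // i ≠ j} → ℂ) × ({i // i ≠ j} → V)) : (ι → V) × V :=
  let c : ι → V := fun i =>
    if h : i = j then
      -(fderiv ℂ f x.1 (b j + ∑ k, x.2.2.1 k • b k) +
        x.2.1 • fderiv ℂ g x.1 (b j + ∑ k, x.2.2.1 k • b k) + ∑ k, x.2.2.1 k • x.2.2.2 k)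
    else x.2.2.2 ⟨i, h⟩
  (c, f x.1 + x.2.1 • g x.1 + ∑ i, b.coord i x.1 • c i)

theorem exists_degenerateParameter_eq {s : ℝ} {c : ι → V} {w z v : V} (hv : v ≠ 0)
    (h0 : affinePerturbation b f g ((s, c, w), z) = 0)
    (h1 : fderiv ℂ f z v + s • fderiv ℂ g z v + ∑ i, b.coord i v • c i = 0) :
    ∃ j x, x.1 = z ∧ degenerateParameter b f g j x = (c, w) := by
  obtain ⟨j, hj⟩ : ∃ j, b.repr v j ≠ 0 := by
    by_contra! h
    exact hv (b.repr.map_eq_zero_iff.1 (Finsupp.ext h))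
  have hsplit : ∀ φ : ι → V, ∑ i, φ i = φ j + ∑ k : {i // i ≠ j}, φ k := fun φ => by
    rw [← Finset.add_sum_erase _ _ (Finset.mem_univ j)]
    congr 1
    exact Finset.sum_subtype _ (by simp) _
  set t := (b.repr v j)⁻¹ with ht
  have htv : b j + ∑ k : {i // i ≠ j}, (t * b.repr v k) • b k = t • v := by
    conv_rhs => rw [← b.sum_repr v, hsplit, smul_add, Finset.smul_sum]
    simp [smul_smul, ht, hj]
  have hc : ∀ i, (degenerateParameter b f g j
      (z, s, fun k => t * b.repr v k, fun k => c k)).1 i = c i := fun i => by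
    by_cases h : i = j
    · subst h
      have h2 := congrArg (fun y => t • y) h1
      rw [hsplit fun i => b.coord i v • c i] at h2
      simp only [smul_add, Finset.smul_sum, smul_smul,
        Module.Basis.coord_apply, smul_zero] at h2
      rw [show t * b.repr v i = 1 from inv_mul_cancel₀ hj, one_smul] at h2
      simp only [degenerateParameter, dite_true]
      rw [htv, map_smul, map_smul, smul_comm s t, neg_eq_iff_add_eq_zero, ← h2]
      abel
    · simp [degenerateParameter, h]
  refine ⟨j, (z, s, fun k => t * b.repr v k, fun k => c k), rfl, Prod.ext (funext hc) ?_⟩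
  have h3 : (degenerateParameter b f g j (z, s, fun k => t * b.repr v k, fun k => c k)).2 =
      f z + s • g z + ∑ i, b.coord i z • c i :=
    congrArg (f z + s • g z + ·)
      (Finset.sum_congr rfl fun i _ => congrArg (b.coord i z • ·) (hc i))
  rw [h3]
  exact sub_eq_zero.1 h0

variable [FiniteDimensional ℂ V]

theorem contDiffAt_degenerateParameter (hE : IsOpen E) (hf : DifferentiableOn ℂ f E)
    (hg : DifferentiableOn ℂ g E) (j : ι)
    {x : V × ℝ × ({i // i ≠ j} → ℂ) × ({i // i ≠ j} → V)} (hx : x.1 ∈ E) :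
    ContDiffAt ℝ 1 (degenerateParameter b f g j) x := by
  have hv : ContDiffAt ℝ 1 (fun x : V × ℝ × ({i // i ≠ j} → ℂ) × ({i // i ≠ j} → V) =>
      b j + ∑ k, x.2.2.1 k • b k) x := by fun_prop
  have hd : ∀ {f : V → V}, DifferentiableOn ℂ f E →
      ContDiffAt ℝ 1 (fun x : V × ℝ × ({i // i ≠ j} → ℂ) × ({i // i ≠ j} → V) =>
        fderiv ℂ f x.1 (b j + ∑ k, x.2.2.1 k • b k)) x := fun {f} hf => by
    have h1 : ContDiffOn ℂ 1 (fderiv ℂ f) E :=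
      ((contDiffOn_succ_iff_fderiv_of_isOpen hE).1
        (contDiffOn_of_differentiableOn_complex hE 2 hf)).2.2
    have h2 := ((h1.contDiffAt (hE.mem_nhds hx)).restrict_scalars ℝ).comp
      (f := Prod.fst) x contDiffAt_fst
    have h3 := (ContinuousLinearMap.restrictScalarsL ℂ V V ℝ ℝ).contDiff.contDiffAt.comp x h2
    exact h3.clm_apply hv
  have hz : ∀ {f : V → V}, DifferentiableOn ℂ f E →
      ContDiffAt ℝ 1 (fun x : V × ℝ × ({i // i ≠ j} → ℂ) × ({i // i ≠ j} → V) => f x.1) x :=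
    fun hf => (contDiffAt_real_of_differentiableOn_complex hE hf 1 hx).comp
      (f := Prod.fst) x contDiffAt_fst
  have hs : ContDiffAt ℝ 1
      (fun x : V × ℝ × ({i // i ≠ j} → ℂ) × ({i // i ≠ j} → V) => x.2.1) x := by fun_prop
  have hc : ∀ i, ContDiffAt ℝ 1 (fun x => (degenerateParameter b f g j x).1 i) x := fun i => by
    by_cases h : i = j
    · simp only [degenerateParameter, h, dite_true]
      exact (((hd hf).add (hs.smul (hd hg))).add (by fun_prop)).neg
    · simp only [degenerateParameter, h, dite_false]
      fun_prop
  refine (contDiffAt_pi.2 hc).prodMk (((hz hf).add (hs.smul (hz hg))).add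
    (ContDiffAt.sum fun i _ => ContDiffAt.smul ?_ (hc i)))
  exact ((b.contDiff_coord i).comp contDiff_fst).contDiffAt

theorem dimH_image_degenerateParameter_lt (hE : IsOpen E) (hf : DifferentiableOn ℂ f E)
    (hg : DifferentiableOn ℂ g E) (j : ι) :
    dimH (degenerateParameter b f g j '' {x | x.1 ∈ E}) <
      Module.finrank ℝ ((ι → V) × V) := by
  have h1 : dimH (degenerateParameter b f g j '' {x | x.1 ∈ E}) ≤
      dimH {x : V × ℝ × ({i // i ≠ j} → ℂ) × ({i // i ≠ j} → V) | x.1 ∈ E} := by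
    refine dimH_image_le_of_locally_lipschitzOn fun x hx => ?_
    obtain ⟨K, t, ht, h⟩ := (contDiffAt_degenerateParameter hE hf hg j hx).exists_lipschitzOnWith
    exact ⟨K, t, mem_nhdsWithin_of_mem_nhds ht, h⟩
  refine (h1.trans (dimH_mono (subset_univ _))).trans_lt ?_
  rw [Real.dimH_univ_eq_finrank]
  have hcard : 0 < Fintype.card ι := Fintype.card_pos_iff.2 ⟨j⟩
  have hV : Module.finrank ℝ V = 2 * Fintype.card ι := by
    rw [finrank_real_of_complex, Module.finrank_eq_card_basis b]
  have hsub : Fintype.card {i // i ≠ j} = Fintype.card ι - 1 := by simp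
  simp only [Module.finrank_prod, Module.finrank_pi_fintype, hV, Complex.finrank_real_complex,
    Module.finrank_self, Finset.sum_const, Finset.card_univ, smul_eq_mul, hsub]
  norm_cast
  obtain ⟨m, hm⟩ := Nat.exists_eq_succ_of_ne_zero hcard.ne'
  rw [hm]
  simp only [Nat.succ_eq_add_one, Nat.add_sub_cancel]
  ring_nf
  omega

theorem dense_nondegenerate_parameters (b : Module.Basis ι ℂ V) (hE : IsOpen E)
    (hf : DifferentiableOn ℂ f E) (hg : DifferentiableOn ℂ g E) :
    Dense {q : (ι → V) × V | ∀ s : ℝ, ∀ z ∈ E, affinePerturbation b f g ((s, q), z) = 0 → ∀ v,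
      fderiv ℂ f z v + s • fderiv ℂ g z v + ∑ i, b.coord i v • q.1 i = 0 → v = 0} := by
  have hsub : (⋃ j, degenerateParameter b f g j '' {x | x.1 ∈ E})ᶜ ⊆
      {q : (ι → V) × V | ∀ s : ℝ, ∀ z ∈ E, affinePerturbation b f g ((s, q), z) = 0 → ∀ v,
      fderiv ℂ f z v + s • fderiv ℂ g z v + ∑ i, b.coord i v • q.1 i = 0 → v = 0} := by
    rintro ⟨c, w⟩ hq s z hz h0 v h1
    by_contra hv
    obtain ⟨j, x, hx, hjx⟩ := exists_degenerateParameter_eq hv h0 h1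
    exact hq (mem_iUnion.2 ⟨j, x, by simpa [hx] using hz, hjx⟩)
  refine Dense.mono hsub ?_
  rcases isEmpty_or_nonempty ι with hι | hι
  · simp
  · refine dense_compl_of_dimH_lt_finrank ?_
    rw [dimH_iUnion]
    obtain ⟨j, hj⟩ := exists_eq_ciSup_of_finite
      (f := fun j => dimH (degenerateParameter b f g j '' {x | x.1 ∈ E}))
    rw [← hj]
    exact dimH_image_degenerateParameter_lt hE hf hg j

end Density

section Rouche

variable {ι V : Type*} [Fintype ι] [NormedAddCommGroup V] [NormedSpace ℂ V]
  {b : Module.Basis ι ℂ V} {f g : V → V} {E D : Set V}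

@[simp]
theorem affinePerturbation_zero (b : Module.Basis ι ℂ V) (f g : V → V) (s : ℝ) (z : V) :
    affinePerturbation b f g ((s, 0), z) = f z + s • g z := by
  simp [affinePerturbation]

theorem exists_differentiable_zero_zero_fderiv_eq_id {a c : V} (hac : a ≠ c) :
    ∃ p : V → V, Differentiable ℂ p ∧ p a = 0 ∧ p c = 0 ∧
      fderiv ℂ p a = .id ℂ V ∧ fderiv ℂ p c = .id ℂ V := by
  obtain ⟨l, hl⟩ := SeparatingDual.exists_eq_one (R := ℂ) (sub_ne_zero.2 hac)
  set p : V → V := fun z => z - c - (3 * l (z - c) ^ 2 - 2 * l (z - c) ^ 3) • (a - c) with hp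
  have hder : ∀ z, HasFDerivAt p (.id ℂ V -
      ((6 * l (z - c) - 6 * l (z - c) ^ 2) • l).smulRight (a - c)) z := fun z => by
    have h1 : HasFDerivAt (fun z => z - c) (.id ℂ V) z := (hasFDerivAt_id z).sub_const c
    have h2 : HasFDerivAt (fun z => l (z - c)) l z := l.hasFDerivAt.comp z h1
    have h3 := h1.sub ((((h2.pow 2).const_mul 3).sub ((h2.pow 3).const_mul 2)).smul_const (a - c))
    refine HasFDerivAt.congr_fderiv (f := p) h3 ?_
    ext v
    simp only [sub_apply, ContinuousLinearMap.smulRight_apply, smul_apply, smul_eq_mul,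
      nsmul_eq_mul]
    congr 2
    push_cast
    ring
  refine ⟨p, fun z => (hder z).differentiableAt, ?_, ?_, ?_, ?_⟩
  · simp only [hp, hl]; norm_num
  · simp [hp]
  · rw [(hder a).fderiv, hl]; ext v; simp
  · rw [(hder c).fderiv]; ext v; simp

variable [FiniteDimensional ℂ V]

theorem frequently_existsUnique_zero_affinePerturbation (b : Module.Basis ι ℂ V) (hE : IsOpen E)
    (hD : IsOpen D) (hDb : Bornology.IsBounded D) (hDE : closure D ⊆ E)
    (hf : DifferentiableOn ℂ f E) (hg : DifferentiableOn ℂ g E)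
    (hlt : ∀ z ∈ frontier D, ‖g z‖ < ‖f z‖) (huniq : ∃! z, z ∈ D ∧ f z = 0)
    (hinj : ∀ z ∈ D, f z = 0 → ∀ v, fderiv ℂ f z v = 0 → v = 0) :
    ∃ᶠ q in 𝓝 (0 : (ι → V) × V), ∃! z, z ∈ D ∧ affinePerturbation b f g ((1, q), z) = 0 := by
  classical
  have : ProperSpace V := FiniteDimensional.proper ℂ V
  have hK : IsCompact (frontier D) :=
    hDb.isCompact_closure.of_isClosed_subset isClosed_frontier frontier_subset_closure
  have hfr0 : ∀ s ∈ Icc (0 : ℝ) 1, ∀ z ∈ frontier D, f z + s • g z ≠ 0 := by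
    intro s hs z hz h
    have h1 : ‖f z‖ = s * ‖g z‖ := by
      rw [eq_neg_of_add_eq_zero_left h, norm_neg, norm_smul, Real.norm_of_nonneg hs.1]
    nlinarith [hlt z hz, norm_nonneg (g z), hs.2]
  have hfr : ∀ᶠ q in 𝓝 (0 : (ι → V) × V), ∀ y ∈ Icc (0 : ℝ) 1 ×ˢ frontier D,
      affinePerturbation b f g ((y.1, q), y.2) ≠ 0 := by
    refine (isCompact_Icc.prod hK).eventually_forall_of_forall_eventually
      (P := fun q y => affinePerturbation b f g ((y.1, q), y.2) ≠ 0) fun y hy => ?_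
    have h1 : ContinuousAt (affinePerturbation b f g) ((y.1, 0), y.2) :=
      (contDiffAt_affinePerturbation hE hf hg (y.1, 0)
        (hDE (frontier_subset_closure hy.2))).continuousAt
    have h2 : ContinuousAt
        (fun x : ((ι → V) × V) × (ℝ × V) => affinePerturbation b f g ((x.2.1, x.1), x.2.2))
        (0, y) :=
      ContinuousAt.comp (g := affinePerturbation b f g) (x := ((0 : (ι → V) × V), y))
        (f := fun x : ((ι → V) × V) × (ℝ × V) => ((x.2.1, x.1), x.2.2)) h1 (by fun_prop)
    exact h2.eventually_ne (by simpa using hfr0 y.1 hy.1 y.2 hy.2)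
  have hstart : ∀ᶠ q in 𝓝 (0 : (ι → V) × V),
      ∃! z, z ∈ D ∧ affinePerturbation b f g ((0, q), z) = 0 := by
    have h1 := eventually_affinePerturbation_existsUnique_iff (b := b) hE hD hDb hDE hf hg (0, 0)
      (by simpa using hfr0 0 (by simp)) (by simpa using hinj)
    have h2 : Tendsto (fun q : (ι → V) × V => ((0 : ℝ), q)) (𝓝 0) (𝓝 (0, 0)) :=
      (Continuous.tendsto (by fun_prop) _)
    filter_upwards [h2.eventually h1] with q hq
    exact hq.2 (by simpa using huniq)
  have hdense := mem_closure_iff_frequently.1 (dense_nondegenerate_parameters b hE hf hg 0)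
  refine (hdense.and_eventually (hfr.and hstart)).mono fun q ⟨hq, hqfr, hq0⟩ => ?_
  have hloc : ∀ s ∈ Icc (0 : ℝ) 1, ∀ᶠ r in 𝓝[Icc 0 1] s,
      ((∃! z, z ∈ D ∧ affinePerturbation b f g ((s, q), z) = 0) ↔
        ∃! z, z ∈ D ∧ affinePerturbation b f g ((r, q), z) = 0) := by
    intro s hs
    have h1 := eventually_affinePerturbation_existsUnique_iff hE hD hDb hDE hf hg (s, q)
      (fun z hz => hqfr (s, z) ⟨hs, hz⟩) (fun z hz => hq s z (hDE (subset_closure hz)))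
    have h2 : Tendsto (fun r : ℝ => (r, q)) (𝓝[Icc 0 1] s) (𝓝 (s, q)) :=
      (Continuous.tendsto (by fun_prop) _).mono_left nhdsWithin_le_nhds
    filter_upwards [h2.eventually h1] with r hr
    exact hr.symm
  exact (isPreconnected_Icc.induction₂ _ hloc (fun _ _ _ _ _ _ => Iff.trans)
    (fun _ _ _ _ => Iff.symm) (left_mem_Icc.2 zero_le_one) (right_mem_Icc.2 zero_le_one)).1 hq0

theorem eventually_injective_add_smul (T : V →L[ℂ] V) :
    ∀ᶠ t in 𝓝[≠] (0 : ℂ), ∀ v, T v + t • v = 0 → v = 0 := by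
  have hfin : {t : ℂ | Module.End.HasEigenvalue (T : V →ₗ[ℂ] V) (-t)}.Finite :=
    (Module.End.finite_hasEigenvalue (T : V →ₗ[ℂ] V)).preimage neg_injective.injOn
  filter_upwards [nhdsNE_le_cofinite 0 hfin.compl_mem_cofinite] with t ht v hv
  by_contra hv0
  refine ht (Module.End.hasEigenvalue_of_hasEigenvector (x := v)
    (Module.End.hasEigenvector_iff.2 ⟨Module.End.mem_eigenspace_iff.2 ?_, hv0⟩))
  rw [neg_smul]
  exact eq_neg_of_add_eq_zero_left hv

theorem eventually_exists_zero_affinePerturbation (b : Module.Basis ι ℂ V) (hE : IsOpen E)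
    (hf : DifferentiableOn ℂ f E) (hg : DifferentiableOn ℂ g E) {a : V} (ha : a ∈ E)
    (h0 : f a + g a = 0) (hinj : ∀ v, fderiv ℂ f a v + fderiv ℂ g a v = 0 → v = 0)
    {W : Set V} (hW : W ∈ 𝓝 a) :
    ∀ᶠ q in 𝓝 (0 : (ι → V) × V), ∃ z ∈ W, affinePerturbation b f g ((1, q), z) = 0 := by
  have : CompleteSpace V := FiniteDimensional.complete ℂ V
  have h1 := eventually_exists_zero_of_nondegenerate
    (contDiffAt_affinePerturbation (b := b) hE hf hg (1, 0) ha) (by simpa using h0)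
    (fun v hv => hinj v (by
      rw [fderiv_affinePerturbation_inr hE hf hg _ ha] at hv
      simpa using hv)) hW
  have h2 : Tendsto (fun q : (ι → V) × V => ((1 : ℝ), q)) (𝓝 0) (𝓝 (1, 0)) :=
    (Continuous.tendsto (by fun_prop) _)
  exact h2.eventually h1

theorem exists_zero_add_of_norm_lt (b : Module.Basis ι ℂ V) (hE : IsOpen E)
    (hD : IsOpen D) (hDb : Bornology.IsBounded D) (hDE : closure D ⊆ E)
    (hf : DifferentiableOn ℂ f E) (hg : DifferentiableOn ℂ g E)
    (hlt : ∀ z ∈ frontier D, ‖g z‖ < ‖f z‖) (huniq : ∃! z, z ∈ D ∧ f z = 0)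
    (hinj : ∀ z ∈ D, f z = 0 → ∀ v, fderiv ℂ f z v = 0 → v = 0) :
    ∃ z ∈ D, f z + g z = 0 := by
  have : ProperSpace V := FiniteDimensional.proper ℂ V
  by_contra! hne
  have h1 := eventually_forall_ne_zero_of_isCompact (p₀ := ((1 : ℝ), (0 : (ι → V) × V)))
    (H := affinePerturbation b f g) hDb.isCompact_closure
    (fun z hz => (contDiffAt_affinePerturbation hE hf hg _ (hDE hz)).continuousAt) fun z hz => by
      rw [affinePerturbation_zero, one_smul]
      by_cases hzD : z ∈ D
      · exact hne z hzD
      · intro h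
        have h2 := hlt z (by rw [hD.frontier_eq]; exact ⟨hz, hzD⟩)
        rw [eq_neg_of_add_eq_zero_left h, norm_neg] at h2
        exact h2.false
  have h2 : Tendsto (fun q : (ι → V) × V => ((1 : ℝ), q)) (𝓝 0) (𝓝 (1, 0)) :=
    (Continuous.tendsto (by fun_prop) _)
  obtain ⟨q, ⟨z, ⟨hz, hz0⟩, -⟩, hq⟩ := ((frequently_existsUnique_zero_affinePerturbation b hE hD hDb
    hDE hf hg hlt huniq hinj).and_eventually (h2.eventually h1)).exists
  exact hq z (subset_closure hz) hz0

theorem zero_add_unique_of_norm_lt (b : Module.Basis ι ℂ V) (hE : IsOpen E)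
    (hD : IsOpen D) (hDb : Bornology.IsBounded D) (hDE : closure D ⊆ E)
    (hf : DifferentiableOn ℂ f E) (hg : DifferentiableOn ℂ g E)
    (hlt : ∀ z ∈ frontier D, ‖g z‖ < ‖f z‖) (huniq : ∃! z, z ∈ D ∧ f z = 0)
    (hinj : ∀ z ∈ D, f z = 0 → ∀ v, fderiv ℂ f z v = 0 → v = 0)
    {a c : V} (ha : a ∈ D) (hc : c ∈ D) (ha0 : f a + g a = 0) (hc0 : f c + g c = 0) : a = c := by
  by_contra hac
  have : ProperSpace V := FiniteDimensional.proper ℂ V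
  have hK : IsCompact (frontier D) :=
    hDb.isCompact_closure.of_isClosed_subset isClosed_frontier frontier_subset_closure
  have hDE' : D ⊆ E := subset_closure.trans hDE
  obtain ⟨p, hp, hpa, hpc, hpa', hpc'⟩ := exists_differentiable_zero_zero_fderiv_eq_id hac
  have hlt' : ∀ᶠ t in 𝓝 (0 : ℂ), ∀ z ∈ frontier D, ‖g z + t • p z‖ < ‖f z‖ := by
    refine hK.eventually_forall_of_forall_eventually
      (P := fun t z => ‖g z + t • p z‖ < ‖f z‖) fun z hz => ?_
    have hzE := hE.mem_nhds (hDE (frontier_subset_closure hz))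
    have hfc : ContinuousAt (fun x : ℂ × V => f x.2) (0, z) :=
      ContinuousAt.comp (f := Prod.snd) (hf.differentiableAt hzE).continuousAt continuousAt_snd
    have hgc : ContinuousAt (fun x : ℂ × V => g x.2) (0, z) :=
      ContinuousAt.comp (f := Prod.snd) (hg.differentiableAt hzE).continuousAt continuousAt_snd
    have hpc : ContinuousAt (fun x : ℂ × V => x.1 • p x.2) (0, z) :=
      (continuous_fst.smul (hp.continuous.comp continuous_snd)).continuousAt
    exact (hgc.add hpc).norm.eventually_lt hfc.norm (by simpa using hlt z hz)
  obtain ⟨t, ⟨hlt, hta⟩, htc⟩ := (((hlt'.filter_mono nhdsWithin_le_nhds).and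
    (eventually_injective_add_smul (fderiv ℂ f a + fderiv ℂ g a))).and
    (eventually_injective_add_smul (fderiv ℂ f c + fderiv ℂ g c))).exists
  have hgt : DifferentiableOn ℂ (fun z => g z + t • p z) E :=
    hg.add (hp.const_smul t).differentiableOn
  have hder : ∀ z ∈ D, fderiv ℂ (fun z => g z + t • p z) z = fderiv ℂ g z + t • fderiv ℂ p z :=
    fun z hz => ((hg.differentiableAt (hE.mem_nhds (hDE' hz))).hasFDerivAt.add
      ((hp z).hasFDerivAt.const_smul t)).fderiv
  obtain ⟨A, C, hA, hC, haA, hcC, hAC⟩ := t2_separation hac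
  have hza := eventually_exists_zero_affinePerturbation b hE hf hgt (hDE' ha)
    (by simpa [hpa] using ha0)
    (fun v hv => hta v (by simpa [hder a ha, hpa', add_assoc] using hv))
    ((hD.inter hA).mem_nhds ⟨ha, haA⟩)
  have hzc := eventually_exists_zero_affinePerturbation b hE hf hgt (hDE' hc)
    (by simpa [hpc] using hc0)
    (fun v hv => htc v (by simpa [hder c hc, hpc', add_assoc] using hv))
    ((hD.inter hC).mem_nhds ⟨hc, hcC⟩)
  obtain ⟨q, hq, ⟨x, hx, hx0⟩, ⟨y, hy, hy0⟩⟩ := ((frequently_existsUnique_zero_affinePerturbation b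
    hE hD hDb hDE hf hgt hlt huniq hinj).and_eventually (hza.and hzc)).exists
  exact hAC.ne_of_mem hx.2 hy.2 (hq.unique ⟨hx.1, hx0⟩ ⟨hy.1, hy0⟩)

end Rouche

/-- Multidimensional Rouché theorem (Aizenberg–Yuzhakov), simple-zero form:
under the Rouché boundary hypotheses, if `f` has exactly one zero `z₀` in `D` and
the Fréchet derivative of `f` at `z₀` is invertible, then `f + g` has exactly one
zero in `D`. -/
theorem rouche_unique_zero
    (n : ℕ) (E D : Set (EuclideanSpace ℂ (Fin n)))
    (hE : IsOpen E) (hD : IsOpen D)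
    (hDbdd : Bornology.IsBounded D) (hDE : closure D ⊆ E)
    (f g : EuclideanSpace ℂ (Fin n) → EuclideanSpace ℂ (Fin n))
    (hf : DifferentiableOn ℂ f E) (hg : DifferentiableOn ℂ g E)
    (hfne : ∀ z ∈ frontier D, f z ≠ 0)
    (hlt : ∀ z ∈ frontier D, ‖g z‖ < ‖f z‖)
    (z₀ : EuclideanSpace ℂ (Fin n)) (hz₀D : z₀ ∈ D) (hz₀ : f z₀ = 0)
    (huniq : ∀ z ∈ D, f z = 0 → z = z₀)
    (hinv : ∃ e : (EuclideanSpace ℂ (Fin n)) ≃L[ℂ] (EuclideanSpace ℂ (Fin n)),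
      (e : EuclideanSpace ℂ (Fin n) →L[ℂ] EuclideanSpace ℂ (Fin n)) = fderiv ℂ f z₀) :
    ∃! z, z ∈ D ∧ f z + g z = 0 := by
  obtain ⟨e, he⟩ := hinv
  have b := (EuclideanSpace.basisFun (Fin n) ℂ).toBasis
  have hex : ∃! z, z ∈ D ∧ f z = 0 := ⟨z₀, ⟨hz₀D, hz₀⟩, fun z hz => huniq z hz.1 hz.2⟩
  have hinj : ∀ z ∈ D, f z = 0 → ∀ v, fderiv ℂ f z v = 0 → v = 0 := by
    intro z hz h v hv
    rw [huniq z hz h, ← he] at hv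
    exact e.map_eq_zero_iff.1 hv
  obtain ⟨a, ha, ha0⟩ := exists_zero_add_of_norm_lt b hE hD hDbdd hDE hf hg hlt hex hinj
  exact ⟨a, ⟨ha, ha0⟩, fun c hc =>
    zero_add_unique_of_norm_lt b hE hD hDbdd hDE hf hg hlt hex hinj hc.1 ha hc.2 ha0⟩
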